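/- arXiv:2402.14959 — 2 statements merged into one kernel-verified Lean document; each statement's English description precedes it below -/
import Mathlib

section
/- Let (Ω, F, μ) be a probability space, let Y, M, R, C be measurable sets, and let B_maj, B_min be measurable conditioning events such that for each d ∈ {maj, min}: μ(B_d) > 0, μ(C ∩ B_d) > 0, μ(Cᶜ ∩ B_d) > 0, μ(R ∩ B_d) > 0, μ(R ∩ C ∩ B_d) > 0 and μ(R ∩ Cᶜ ∩ B_d) > 0. Assume: (parity in law enforcement) P[Y ∩ M ∣ R ∩ C ∩ B_maj] = P[Y ∩ M ∣ R ∩ C ∩ B_min] and P[Y ∩ M ∣ R ∩ Cᶜ ∩ B_maj] = P[Y ∩ M ∣ R ∩ Cᶜ ∩ B_min]; (parity in reporting) P[R ∣ C ∩ B_maj] = P[R ∣ C ∩ B_min] and P[R ∣ Cᶜ ∩ B_maj] = P[R ∣ Cᶜ ∩ B_min]; (criminality independent of race given context) P[C ∣ B_maj] = P[C ∣ B_min]. Then there is observational parity in law enforcement: P[Y ∩ M ∣ R ∩ B_maj] = P[Y ∩ M ∣ R ∩ B_min]. (This is the paper's Proposition 2.) -/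
open MeasureTheory ProbabilityTheory Filter

/-- Conditional probability `P[A ∣ B] = μ(A ∩ B)/μ(B)` as a real number,
via Mathlib's `ProbabilityTheory.cond`. -/
noncomputable def condP {Ω : Type*} [MeasurableSpace Ω] (μ : Measure Ω) (A B : Set Ω) : ℝ :=
  ((ProbabilityTheory.cond μ B) A).toReal

lemma condP_eq_div {Ω : Type*} [MeasurableSpace Ω] (μ : Measure Ω) (A : Set Ω) {B : Set Ω}
    (hB : MeasurableSet B) : condP μ A B = μ.real (B ∩ A) / μ.real B := by
  rw [condP, cond_apply hB, ENNReal.toReal_mul, ENNReal.toReal_inv, div_eq_inv_mul]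
  rfl

lemma condP_mul_real {Ω : Type*} [MeasurableSpace Ω] (μ : Measure Ω) [IsFiniteMeasure μ]
    (A : Set Ω) {B : Set Ω} (hB : MeasurableSet B) :
    condP μ A B * μ.real B = μ.real (B ∩ A) := by
  rw [condP_eq_div μ A hB]
  refine div_mul_cancel_of_imp fun h => ?_
  exact le_antisymm (h ▸ measureReal_mono Set.inter_subset_left) measureReal_nonneg

/-- Bayes' rule together with the law of total probability over `C` and `Cᶜ`. -/
lemma condP_inter_eq_mixture {Ω : Type*} [MeasurableSpace Ω] (μ : Measure Ω) [IsFiniteMeasure μ]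
    (A : Set Ω) {R C B : Set Ω} (hR : MeasurableSet R) (hC : MeasurableSet C)
    (hB : MeasurableSet B) (hB₀ : μ.real B ≠ 0) :
    condP μ A (R ∩ B) =
      (condP μ A (R ∩ C ∩ B) * (condP μ R (C ∩ B) * condP μ C B) +
        condP μ A (R ∩ Cᶜ ∩ B) * (condP μ R (Cᶜ ∩ B) * (1 - condP μ C B))) /
      (condP μ R (C ∩ B) * condP μ C B + condP μ R (Cᶜ ∩ B) * (1 - condP μ C B)) := by
  have split (S : Set Ω) : μ.real (C ∩ S) + μ.real (Cᶜ ∩ S) = μ.real S := by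
    rw [Set.inter_comm C, Set.inter_comm Cᶜ, ← Set.sdiff_eq]
    exact measureReal_inter_add_sdiff hC
  have hc : condP μ C B * μ.real B = μ.real (C ∩ B) := by
    rw [condP_mul_real μ C hB, Set.inter_comm]
  have hc' : (1 - condP μ C B) * μ.real B = μ.real (Cᶜ ∩ B) := by
    linarith [split B]
  have hr {D : Set Ω} (hD : MeasurableSet D) :
      condP μ R (D ∩ B) * μ.real (D ∩ B) = μ.real (R ∩ D ∩ B) := by
    rw [condP_mul_real μ R (hD.inter hB), Set.inter_comm, Set.inter_assoc]
  have ha {D : Set Ω} (hD : MeasurableSet D) :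
      condP μ A (R ∩ D ∩ B) * μ.real (R ∩ D ∩ B) = μ.real (D ∩ (R ∩ B ∩ A)) := by
    rw [condP_mul_real μ A ((hR.inter hD).inter hB)]
    congr 1
    ac_rfl
  have hden : μ.real (R ∩ C ∩ B) + μ.real (R ∩ Cᶜ ∩ B) = μ.real (R ∩ B) := by
    rw [← split (R ∩ B), Set.inter_left_comm C, Set.inter_left_comm Cᶜ, Set.inter_assoc,
      Set.inter_assoc]
  rw [condP_eq_div μ A (hR.inter hB)]
  refine Eq.trans ?_ (mul_div_mul_right _ _ hB₀)
  congr 1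
  · rw [← split (R ∩ B ∩ A), ← ha hC, ← ha hC.compl, ← hr hC, ← hr hC.compl, ← hc, ← hc']
    ring
  · rw [← hden, ← hr hC, ← hr hC.compl, ← hc, ← hc']
    ring

theorem stmt4 {Ω : Type*} [MeasurableSpace Ω] (μ : Measure Ω) [IsProbabilityMeasure μ]
    (Y M R C Bmaj Bmin : Set Ω)
    (hYm : MeasurableSet Y) (hMm : MeasurableSet M) (hRm : MeasurableSet R)
    (hCm : MeasurableSet C) (hBmajm : MeasurableSet Bmaj) (hBminm : MeasurableSet Bmin)
    (hBmaj : 0 < μ Bmaj) (hCBmaj : 0 < μ (C ∩ Bmaj)) (hCcBmaj : 0 < μ (Cᶜ ∩ Bmaj))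
    (hRBmaj : 0 < μ (R ∩ Bmaj)) (hRCBmaj : 0 < μ (R ∩ C ∩ Bmaj)) (hRCcBmaj : 0 < μ (R ∩ Cᶜ ∩ Bmaj))
    (hBmin : 0 < μ Bmin) (hCBmin : 0 < μ (C ∩ Bmin)) (hCcBmin : 0 < μ (Cᶜ ∩ Bmin))
    (hRBmin : 0 < μ (R ∩ Bmin)) (hRCBmin : 0 < μ (R ∩ C ∩ Bmin)) (hRCcBmin : 0 < μ (R ∩ Cᶜ ∩ Bmin))
    (hLEcri : condP μ (Y ∩ M) (R ∩ C ∩ Bmaj) = condP μ (Y ∩ M) (R ∩ C ∩ Bmin))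
    (hLEinn : condP μ (Y ∩ M) (R ∩ Cᶜ ∩ Bmaj) = condP μ (Y ∩ M) (R ∩ Cᶜ ∩ Bmin))
    (hRcri : condP μ R (C ∩ Bmaj) = condP μ R (C ∩ Bmin))
    (hRinn : condP μ R (Cᶜ ∩ Bmaj) = condP μ R (Cᶜ ∩ Bmin))
    (hCD : condP μ C Bmaj = condP μ C Bmin) :
    condP μ (Y ∩ M) (R ∩ Bmaj) = condP μ (Y ∩ M) (R ∩ Bmin) := by
  have hreal {B : Set Ω} (hB : 0 < μ B) : μ.real B ≠ 0 :=
    ENNReal.toReal_ne_zero.2 ⟨hB.ne', measure_ne_top μ B⟩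
  rw [condP_inter_eq_mixture μ (Y ∩ M) hRm hCm hBmajm (hreal hBmaj),
    condP_inter_eq_mixture μ (Y ∩ M) hRm hCm hBminm (hreal hBmin),
    hLEcri, hLEinn, hRcri, hRinn, hCD]
end

section
/- Fix real numbers Y_cri_maj, Y_cri_min ∈ [0,1]. Let (ξ_maj_n), (ξ_min_n), (Y_inn_maj_n), (Y_inn_min_n) be sequences in [0,1] with ξ_maj_n − ξ_min_n → 0 and Y_inn_maj_n − Y_inn_min_n → 0, and let Δ_n := (Y_inn_maj_n·ξ_maj_n + Y_cri_maj·(1 − ξ_maj_n)) − (Y_inn_min_n·ξ_min_n + Y_cri_min·(1 − ξ_min_n)). Then Δ_n − (1 − ξ_maj_n)·(Y_cri_maj − Y_cri_min) → 0. (This is the paper's Proposition 6, Scenario 3 Case 2: unbiased public reporting and unbiased policing actions against innocents.) -/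
open Filter Topology

theorem stmt10 (Ycrimaj Ycrimin : ℝ)
    (hYcrimaj : Ycrimaj ∈ Set.Icc (0:ℝ) 1) (hYcrimin : Ycrimin ∈ Set.Icc (0:ℝ) 1)
    (ximaj ximin Yinnmaj Yinnmin : ℕ → ℝ)
    (hximaj : ∀ n, ximaj n ∈ Set.Icc (0:ℝ) 1) (hximin : ∀ n, ximin n ∈ Set.Icc (0:ℝ) 1)
    (hYinnmaj : ∀ n, Yinnmaj n ∈ Set.Icc (0:ℝ) 1) (hYinnmin : ∀ n, Yinnmin n ∈ Set.Icc (0:ℝ) 1)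
    (hxi : Tendsto (fun n => ximaj n - ximin n) atTop (𝓝 0))
    (hYinn : Tendsto (fun n => Yinnmaj n - Yinnmin n) atTop (𝓝 0))
    (Δ : ℕ → ℝ)
    (hΔ : ∀ n, Δ n = (Yinnmaj n * ximaj n + Ycrimaj * (1 - ximaj n))
        - (Yinnmin n * ximin n + Ycrimin * (1 - ximin n))) :
    Tendsto (fun n => Δ n - (1 - ximaj n) * (Ycrimaj - Ycrimin)) atTop (𝓝 0) := by
  have hbound : Tendsto (fun n => |Yinnmaj n - Yinnmin n| + |ximaj n - ximin n|) atTop (𝓝 0) := by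
    simpa using hYinn.abs.add hxi.abs
  refine squeeze_zero_norm (fun n => ?_) hbound
  have hdecomp : Δ n - (1 - ximaj n) * (Ycrimaj - Ycrimin)
      = (Yinnmaj n - Yinnmin n) * ximaj n + (Yinnmin n - Ycrimin) * (ximaj n - ximin n) := by
    rw [hΔ]
    ring
  have hximaj_abs : |ximaj n| ≤ 1 :=
    abs_le.2 ⟨by linarith [(hximaj n).1], (hximaj n).2⟩
  have hY_abs : |Yinnmin n - Ycrimin| ≤ 1 :=
    abs_le.2 ⟨by linarith [(hYinnmin n).1, hYcrimin.2], by linarith [(hYinnmin n).2, hYcrimin.1]⟩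
  rw [hdecomp, Real.norm_eq_abs]
  refine (abs_add_le _ _).trans (add_le_add ?_ ?_)
  · rw [abs_mul]
    exact mul_le_of_le_one_right (abs_nonneg _) hximaj_abs
  · rw [abs_mul]
    exact mul_le_of_le_one_left (abs_nonneg _) hY_abs
end
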